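/- Let c ∈ ℚ with c ≠ 0, let x : ℕ → ℤ, and for each i ≥ 1 let J_i be a finite index set with coefficients a_{i,j} ∈ ℚ and shifts b_{i,j} ∈ ℤ (j ∈ J_i). Assume Σ_{j∈J_1} a_{1,j} ≠ 0 and that b_{i,j} ≤ x_n − x_{n−i} + 1 for all n ≥ 1, all 1 ≤ i ≤ n, and all j ∈ J_i. Let F : ℕ → ℤ → ℚ satisfy: F_n(m) = 0 for all m < x_n; F_0(m) = c for all m ≥ x_0; and for every n ≥ 0 and every integer m > x_n, F_n(m) = F_n(m−1) + Σ_{i=1}^{n} Σ_{j∈J_i} a_{i,j} F_{n−i}(m − b_{i,j}). Then there exists a sequence of polynomials f_n ∈ ℚ[X] with deg f_n = n such that F_n(m) = f_n(m) for every n ≥ 0 and every integer m ≥ x_n. -/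

import Mathlib

open Polynomial in
/-- A rational polynomial of degree `d` is the backward difference of one of degree `d + 1`. -/
theorem Polynomial.exists_backward_antidifference {g : ℚ[X]} {d : ℕ} (hg : g.degree = d) :
    ∃ h : ℚ[X], h.degree = (d + 1 : ℕ) ∧ ∀ y : ℚ, h.eval y - h.eval (y - 1) = g.eval y := by
  have hd : g.natDegree = d := natDegree_eq_of_degree_eq_some hg
  refine ⟨taylor 1 (∑ k ∈ Finset.range (d + 1),
    C (g.coeff k / (k + 1)) * bernoulli (k + 1)), ?_, fun y => ?_⟩
  · rw [degree_taylor]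
    refine degree_eq_of_le_of_coeff_ne_zero (natDegree_le_iff_degree_le.mp ?_) ?_
    · refine natDegree_sum_le_of_forall_le _ _ fun k hk => (natDegree_C_mul_le _ _).trans ?_
      rw [natDegree_le_iff_coeff_eq_zero]
      intro N hN
      rw [coeff_bernoulli, if_neg]
      have := Finset.mem_range.mp hk
      omega
    · rw [finsetSum_coeff, Finset.sum_eq_single d]
      · have hlead : g.coeff d ≠ 0 := coeff_ne_zero_of_eq_degree hg
        have : (d : ℚ) + 1 ≠ 0 := by positivity
        simp [coeff_bernoulli, hlead, this]
      · intro k hk hkd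
        have := Finset.mem_range.mp hk
        rw [coeff_C_mul, coeff_bernoulli, if_neg (by omega), mul_zero]
      · simp
  · rw [taylor_eval, taylor_eval, sub_add_cancel, eval_finsetSum, eval_finsetSum,
      ← Finset.sum_sub_distrib, eval_eq_sum_range, hd]
    refine Finset.sum_congr rfl fun k _ => ?_
    have : (k : ℚ) + 1 ≠ 0 := by positivity
    rw [eval_C_mul, eval_C_mul, add_comm y, bernoulli_eval_one_add]
    push_cast
    field_simp
    ring

open Polynomial in
/-- A combination of translates of polynomials of degrees `n, n - 1, …, 0` has degree `n`
provided the weights at the polynomial of degree `n` do not sum to zero. -/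
theorem Polynomial.degree_sum_C_mul_taylor {n : ℕ} {f : ℕ → ℚ[X]}
    (hf : ∀ k < n + 1, (f k).degree = k) (N : ℕ → ℕ) (a r : ℕ → ℕ → ℚ)
    (ha : ∑ j ∈ Finset.range (N 1), a 1 j ≠ 0) :
    (∑ i ∈ Finset.Icc 1 (n + 1), ∑ j ∈ Finset.range (N i),
      C (a i j) * taylor (r i j) (f (n + 1 - i))).degree = n := by
  have hnat : ∀ k < n + 1, (f k).natDegree = k := fun k hk =>
    natDegree_eq_of_degree_eq_some (hf k hk)
  refine degree_eq_of_le_of_coeff_ne_zero (natDegree_le_iff_degree_le.mp ?_) ?_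
  · refine natDegree_sum_le_of_forall_le _ _ fun i hi =>
      natDegree_sum_le_of_forall_le _ _ fun j _ => (natDegree_C_mul_le _ _).trans ?_
    have := Finset.mem_Icc.mp hi
    rw [natDegree_taylor, hnat _ (by omega)]
    omega
  · rw [finsetSum_coeff, Finset.sum_eq_single 1]
    · have hlead : ∀ s : ℚ, (taylor s (f n)).coeff n = (f n).coeff n := fun s => by
        have := coeff_taylor_natDegree (r := s) (f := f n)
        rwa [leadingCoeff, hnat n n.lt_succ_self] at this
      simp only [Nat.add_sub_cancel, finsetSum_coeff, coeff_C_mul, hlead, ← Finset.sum_mul]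
      exact mul_ne_zero ha (coeff_ne_zero_of_eq_degree (hf n n.lt_succ_self))
    · intro i hi hi1
      have := Finset.mem_Icc.mp hi
      rw [finsetSum_coeff]
      refine Finset.sum_eq_zero fun j _ => ?_
      rw [coeff_C_mul, coeff_eq_zero_of_natDegree_lt, mul_zero]
      rw [natDegree_taylor, hnat _ (by omega)]
      omega
    · simp


/-- Existence theorem for polynomial sequences: given a recurrence
`F n m = F n (m-1) + ∑_{i=1}^{n} ∑_{j ∈ J i} a i j • F (n-i) (m - b i j)` (each `J i` finite,
modeled as `Finset.range (N i)`), with `F n m = 0` for `m < x n`, `F 0 m = c ≠ 0` for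
`m ≥ x 0`, `∑_{j ∈ J 1} a 1 j ≠ 0`, and `b i j ≤ x n - x (n-i) + 1` for all `1 ≤ i ≤ n`,
there is a sequence of polynomials `f n` of degree `n` with `F n m = f n (m)` for all
`m ≥ x n`. -/
theorem exists_polynomial_sequence
    (c : ℚ) (hc : c ≠ 0) (x : ℕ → ℤ)
    (N : ℕ → ℕ) (a : ℕ → ℕ → ℚ) (b : ℕ → ℕ → ℤ)
    (ha1 : ∑ j ∈ Finset.range (N 1), a 1 j ≠ 0)
    (hb : ∀ n : ℕ, 1 ≤ n → ∀ i : ℕ, 1 ≤ i → i ≤ n → ∀ j ∈ Finset.range (N i),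
      b i j ≤ x n - x (n - i) + 1)
    (F : ℕ → ℤ → ℚ)
    (hFzero : ∀ n : ℕ, ∀ m : ℤ, m < x n → F n m = 0)
    (hF0 : ∀ m : ℤ, x 0 ≤ m → F 0 m = c)
    (hFrec : ∀ n : ℕ, ∀ m : ℤ, x n < m →
      F n m = F n (m - 1) + ∑ i ∈ Finset.Icc 1 n, ∑ j ∈ Finset.range (N i),
        a i j * F (n - i) (m - b i j)) :
    ∃ f : ℕ → Polynomial ℚ, (∀ n : ℕ, (f n).degree = n) ∧
      ∀ n : ℕ, ∀ m : ℤ, x n ≤ m → F n m = (f n).eval (m : ℚ) := by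
  suffices H : ∀ n : ℕ, ∃ p : Polynomial ℚ, p.degree = n ∧
      ∀ m : ℤ, x n ≤ m → F n m = p.eval (m : ℚ) by
    choose f hf using H
    exact ⟨f, fun n => (hf n).1, fun n => (hf n).2⟩
  intro n
  induction n using Nat.strong_induction_on with
  | _ n ih =>
    cases n with
    | zero => exact ⟨Polynomial.C c, by simp [Polynomial.degree_C hc],
        fun m hm => by rw [hF0 m hm, Polynomial.eval_C]⟩
    | succ n =>
      choose! f hfdeg hfeval using ih
      obtain ⟨h, hdeg, hdiff⟩ := Polynomial.exists_backward_antidifference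
        (Polynomial.degree_sum_C_mul_taylor hfdeg N a (fun i j => -(b i j : ℚ)) ha1)
      refine ⟨h + Polynomial.C (F (n + 1) (x (n + 1)) - h.eval (x (n + 1) : ℚ)), ?_, ?_⟩
      · rw [Polynomial.degree_add_C, hdeg]
        rw [hdeg]
        exact_mod_cast n.succ_pos
      · intro m hm
        induction m, hm using Int.leInduction with
        | base => simp
        | succ m hm ihm =>
          have hstep := hdiff ((m + 1 : ℤ) : ℚ)
          have hsum : ∑ i ∈ Finset.Icc 1 (n + 1), ∑ j ∈ Finset.range (N i),
              a i j * F (n + 1 - i) (m + 1 - b i j) =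
              (∑ i ∈ Finset.Icc 1 (n + 1), ∑ j ∈ Finset.range (N i), Polynomial.C (a i j) *
                Polynomial.taylor (-(b i j : ℚ)) (f (n + 1 - i))).eval ((m + 1 : ℤ) : ℚ) := by
            simp only [Polynomial.eval_finsetSum, Polynomial.eval_C_mul, Polynomial.taylor_eval]
            refine Finset.sum_congr rfl fun i hi => Finset.sum_congr rfl fun j hj => ?_
            obtain ⟨hi1, hin⟩ := Finset.mem_Icc.mp hi
            have hbij := hb (n + 1) (by omega) i hi1 hin j hj
            rw [hfeval (n + 1 - i) (by omega) _ (by omega)]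
            push_cast
            rw [sub_eq_add_neg]
          rw [hFrec (n + 1) (m + 1) (by omega), hsum, ← hstep, add_sub_cancel_right, ihm]
          simp only [Polynomial.eval_add, Polynomial.eval_C]
          push_cast
          rw [add_sub_cancel_right]
          ring
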